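/- Let φ : {a,b} → ℝ with φ(a) ≠ φ(b). If u and v are two finite words over {a,b} of the same length n ≥ 1 such that S⁽ⁱ⁾ₙ(φ,u) = S⁽ⁱ⁾ₙ(φ,v) for every integer i with 1 ≤ i ≤ n, then u = v. -/

import Mathlib

/-- The two-letter alphabet `{a, b}`. -/
inductive AB : Type
  | a : AB
  | b : AB
deriving DecidableEq

/-- Iterated Birkhoff sums of a sequence `u`: `birkhoff u 0 n = u n` and
`birkhoff u (ℓ+1) n = ∑_{k<n} birkhoff u ℓ k`.  For `i ≥ 1`, `birkhoff u i`
is the paper's `S⁽ⁱ⁾(u)`. -/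
def birkhoff (u : ℕ → ℝ) : ℕ → ℕ → ℝ
  | 0, n => u n
  | ℓ + 1, n => ∑ k ∈ Finset.range n, birkhoff u ℓ k

/-- `SW φ u i n` is the iterated Birkhoff sum `S⁽ⁱ⁾ₙ(φ, u)` of `φ` along the finite
word `u` (only the first `n ≤ |u|` letters are used). -/
def SW (φ : AB → ℝ) (u : List AB) (i n : ℕ) : ℝ :=
  birkhoff (fun k => φ (u.getD k AB.a)) i n

theorem birkhoff_eq_zero (f : ℕ → ℝ) : ∀ i m : ℕ, m < i → birkhoff f i m = 0 := by
  intro i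
  induction i with
  | zero => intro m hm; omega
  | succ i ih =>
    intro m hm
    rw [birkhoff]
    apply Finset.sum_eq_zero
    intro k hk
    rw [Finset.mem_range] at hk
    exact ih k (by omega)

theorem birkhoff_step (f : ℕ → ℝ) (i m : ℕ) :
    birkhoff f (i + 1) (m + 1) = birkhoff f (i + 1) m + birkhoff f i m := by
  simp only [birkhoff]
  rw [Finset.sum_range_succ]

theorem birkhoff_down (f g : ℕ → ℝ) (m : ℕ)
    (h : ∀ i, 1 ≤ i → i ≤ m + 1 → birkhoff f i (m + 1) = birkhoff g i (m + 1)) :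
    ∀ j i, i + j = m + 1 → birkhoff f i m = birkhoff g i m := by
  intro j
  induction j with
  | zero =>
    intro i hi
    rw [birkhoff_eq_zero f i m (by omega), birkhoff_eq_zero g i m (by omega)]
  | succ j ih =>
    intro i hi
    have h1 := ih (i + 1) (by omega)
    have h2 := h (i + 1) (by omega) (by omega)
    rw [birkhoff_step, birkhoff_step] at h2
    linarith

theorem birkhoff_inj (f g : ℕ → ℝ) : ∀ n : ℕ,
    (∀ i, 1 ≤ i → i ≤ n → birkhoff f i n = birkhoff g i n) → ∀ k < n, f k = g k := by
  intro n
  induction n with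
  | zero => intro _ k hk; omega
  | succ m ih =>
    intro h k hk
    have hd := birkhoff_down f g m h
    rcases Nat.lt_succ_iff_lt_or_eq.mp hk with hk | rfl
    · exact ih (fun i _ hi => hd (m + 1 - i) i (by omega)) k hk
    · have := hd (k + 1) 0 (by omega)
      simpa [birkhoff] using this

/-- **Proposition (injectivity of `π_φ`).** Two words of the same length `n ≥ 1`
having the same iterated Birkhoff sums `S⁽ⁱ⁾ₙ(φ,·)` for `1 ≤ i ≤ n` are equal,
provided `φ(a) ≠ φ(b)`. -/
theorem birkhoff_sums_injective (φ : AB → ℝ) (hφ : φ AB.a ≠ φ AB.b)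
    (n : ℕ) (hn : 1 ≤ n) (u v : List AB) (hu : u.length = n) (hv : v.length = n)
    (h : ∀ i : ℕ, 1 ≤ i → i ≤ n → SW φ u i n = SW φ v i n) :
    u = v := by
  have key := birkhoff_inj _ _ n h
  apply List.ext_getElem (by omega)
  intro k h1 h2
  have hk := key k (by omega)
  simp only [List.getD_eq_getElem _ _ h1, List.getD_eq_getElem _ _ h2] at hk
  revert hk
  generalize u[k] = x
  generalize v[k] = y
  intro hk
  cases x <;> cases y
  · rfl
  · exact absurd hk hφ
  · exact absurd hk.symm hφ
  · rfl
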